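/- For any set S of n points in general position in the plane with h extreme points, X_{4,1}(S) ≥ X_{3,1}(S) − n + h. -/

import Mathlib

open Finset
open scoped Classical

def GenPos (S : Finset (ℝ × ℝ)) : Prop :=
  ∀ T ⊆ S, T.card = 3 → ¬ Collinear ℝ (T : Set (ℝ × ℝ))

def ConvexPos (T : Finset (ℝ × ℝ)) : Prop :=
  ∀ p ∈ T, p ∉ convexHull ℝ ((T : Set (ℝ × ℝ)) \ {p})

/-- number of convex k-gons with vertices in S and exactly l points of S inside -/
noncomputable def X (S : Finset (ℝ × ℝ)) (k l : ℕ) : ℕ :=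
  ((Finset.powersetCard k S).filter (fun T => ConvexPos T ∧
    (S.filter (fun p => p ∈ interior (convexHull ℝ (T : Set (ℝ × ℝ))))).card = l)).card

/-- number of extreme points (convex hull vertices) of S -/
noncomputable def hullVerts (S : Finset (ℝ × ℝ)) : ℕ :=
  (S.filter (fun p => p ∉ convexHull ℝ ((S : Set (ℝ × ℝ)) \ {p}))).card

/-- orientation determinant -/
def dt (a b c : ℝ × ℝ) : ℝ := (b.1 - a.1) * (c.2 - a.2) - (b.2 - a.2) * (c.1 - a.1)

/-- linear functional -/
def lf (t : ℝ) (x : ℝ × ℝ) : ℝ := x.1 + t * x.2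

lemma dt_convex (s : ℝ) (a b : ℝ × ℝ) : Convex ℝ {y | 0 ≤ s * dt a b y} := by
  intro x hx y hy u v hu hv huv
  simp only [Set.mem_ofPred_eq, dt, Prod.fst_add, Prod.snd_add, Prod.smul_fst, Prod.smul_snd,
    smul_eq_mul] at *
  have hv' : v = 1 - u := by linarith
  subst hv'
  have h1 := mul_nonneg hu hx
  have h2 := mul_nonneg hv hy
  nlinarith

lemma hull_half (s : ℝ) (a b : ℝ × ℝ) (T : Set (ℝ × ℝ)) (hT : ∀ x ∈ T, 0 ≤ s * dt a b x)
    (y : ℝ × ℝ) (hy : y ∈ convexHull ℝ T) : 0 ≤ s * dt a b y :=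
  convexHull_min (s := T) (t := {y | 0 ≤ s * dt a b y}) hT (dt_convex s a b) hy

lemma int_half (s : ℝ) (hs : s ≠ 0) (a b : ℝ × ℝ) (hab : a ≠ b) (T : Set (ℝ × ℝ))
    (hT : ∀ x ∈ T, 0 ≤ s * dt a b x)
    (y : ℝ × ℝ) (hy : y ∈ interior (convexHull ℝ T)) : 0 < s * dt a b y := by
  set n : ℝ × ℝ := (s * (b.2 - a.2), - (s * (b.1 - a.1))) with hn
  have hcont : Continuous (fun r : ℝ => y + r • n) := by fun_prop
  have hopen : IsOpen ((fun r : ℝ => y + r • n) ⁻¹' interior (convexHull ℝ T)) :=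
    isOpen_interior.preimage hcont
  have h0 : (0 : ℝ) ∈ ((fun r : ℝ => y + r • n) ⁻¹' interior (convexHull ℝ T)) := by
    simpa using hy
  obtain ⟨e, he, hball⟩ := Metric.isOpen_iff.1 hopen 0 h0
  have hm : e / 2 ∈ Metric.ball (0 : ℝ) e := by
    simp only [Metric.mem_ball, dist_zero_right, Real.norm_eq_abs]
    rw [abs_of_pos (by linarith)]; linarith
  have h2 := hull_half s a b T hT _ (interior_subset (hball hm))
  have hne : 0 < (b.1 - a.1) ^ 2 + (b.2 - a.2) ^ 2 := by
    by_contra hcon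
    apply hab
    have e1 : (b.1 - a.1) ^ 2 = 0 := by nlinarith [sq_nonneg (b.1 - a.1), sq_nonneg (b.2 - a.2)]
    have e2 : (b.2 - a.2) ^ 2 = 0 := by nlinarith [sq_nonneg (b.1 - a.1), sq_nonneg (b.2 - a.2)]
    have e1' := pow_eq_zero_iff (two_ne_zero) |>.1 e1
    have e2' := pow_eq_zero_iff (two_ne_zero) |>.1 e2
    ext <;> linarith
  have key : s * dt a b (y + (e / 2) • n)
      = s * dt a b y - s ^ 2 * (e / 2) * ((b.1 - a.1) ^ 2 + (b.2 - a.2) ^ 2) := by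
    simp only [dt, hn, Prod.fst_add, Prod.snd_add, Prod.smul_fst, Prod.smul_snd, smul_eq_mul]
    ring
  rw [key] at h2
  have : 0 < s ^ 2 * (e / 2) * ((b.1 - a.1) ^ 2 + (b.2 - a.2) ^ 2) := by positivity
  linarith

lemma ne_of_dt {s : ℝ} {a b c : ℝ × ℝ} (h : 0 < s * dt a b c) : a ≠ b ∧ b ≠ c ∧ a ≠ c := by
  refine ⟨?_, ?_, ?_⟩ <;> rintro rfl <;> (simp only [dt] at h; ring_nf at h; simp at h)

lemma tri_mem (s : ℝ) (a b c y : ℝ × ℝ)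
    (h1 : 0 < s * dt a b y) (h2 : 0 < s * dt b c y) (h3 : 0 < s * dt c a y) :
    y ∈ interior (convexHull ℝ ({a, b, c} : Set (ℝ × ℝ))) := by
  have hopen : IsOpen {y : ℝ × ℝ | 0 < s * dt a b y ∧ 0 < s * dt b c y ∧ 0 < s * dt c a y} := by
    have hc : ∀ a b : ℝ × ℝ, IsOpen {y : ℝ × ℝ | 0 < s * dt a b y} := by
      intro a b
      apply isOpen_lt continuous_const
      unfold dt; fun_prop
    exact (hc a b).inter ((hc b c).inter (hc c a))
  refine interior_maximal ?_ hopen ⟨h1, h2, h3⟩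
  rintro z ⟨h1, h2, h3⟩
  have hsum : s * dt a b c = s * dt a b z + s * dt b c z + s * dt c a z := by
    simp only [dt]; ring
  have hpos : 0 < s * dt a b c := by linarith
  have hd : s * dt a b c ≠ 0 := hpos.ne'
  have hz : z = (s * dt b c z / (s * dt a b c)) • a + (s * dt c a z / (s * dt a b c)) • b
      + (s * dt a b z / (s * dt a b c)) • c := by
    have hid1 : s * dt a b c * z.1 = s * dt b c z * a.1 + s * dt c a z * b.1 + s * dt a b z * c.1 := by
      simp only [dt]; ring
    have hid2 : s * dt a b c * z.2 = s * dt b c z * a.2 + s * dt c a z * b.2 + s * dt a b z * c.2 := by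
      simp only [dt]; ring
    generalize s * dt a b c = d at *
    ext
    · simp only [Prod.fst_add, Prod.smul_fst, smul_eq_mul]
      field_simp
      linarith
    · simp only [Prod.snd_add, Prod.smul_snd, smul_eq_mul]
      field_simp
      linarith
  have hcv := convex_convexHull ℝ ({a, b, c} : Set (ℝ × ℝ))
  have ha : a ∈ convexHull ℝ ({a, b, c} : Set (ℝ × ℝ)) := subset_convexHull _ _ (by simp)
  have hb : b ∈ convexHull ℝ ({a, b, c} : Set (ℝ × ℝ)) := subset_convexHull _ _ (by simp)
  have hc : c ∈ convexHull ℝ ({a, b, c} : Set (ℝ × ℝ)) := subset_convexHull _ _ (by simp)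
  rw [hz]
  have := hcv.sum_mem (t := Finset.univ) (w := ![s * dt b c z / (s * dt a b c),
    s * dt c a z / (s * dt a b c), s * dt a b z / (s * dt a b c)]) (z := ![a, b, c])
    (by intro i _; fin_cases i <;> simp <;> positivity)
    (by simp [Fin.sum_univ_three]; rw [← add_div, ← add_div, div_eq_one_iff_eq hd]; linarith)
    (by intro i _; fin_cases i <;> simp [ha, hb, hc])
  simpa [Fin.sum_univ_three] using this

lemma tri_int (s : ℝ) (a b c y : ℝ × ℝ) (h : 0 < s * dt a b c)
    (hy : y ∈ interior (convexHull ℝ ({a, b, c} : Set (ℝ × ℝ)))) :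
    0 < s * dt a b y ∧ 0 < s * dt b c y ∧ 0 < s * dt c a y := by
  have hs : s ≠ 0 := by rintro rfl; simp at h
  obtain ⟨n1, n2, n3⟩ := ne_of_dt h
  have e1 : ∀ a b : ℝ × ℝ, s * dt a b a = 0 := by intros; simp only [dt]; ring
  have e2 : ∀ a b : ℝ × ℝ, s * dt a b b = 0 := by intros; simp only [dt]; ring
  have e3 : dt b c a = dt a b c := by simp only [dt]; ring
  have e4 : dt c a b = dt a b c := by simp only [dt]; ring
  refine ⟨int_half s hs a b n1 _ ?_ y hy, int_half s hs b c n2 _ ?_ y hy,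
    int_half s hs c a n3.symm _ ?_ y hy⟩ <;>
  · intro x hx
    simp only [Set.mem_insert_iff, Set.mem_singleton_iff] at hx
    rcases hx with rfl | rfl | rfl <;> simp only [e1, e2, e3, e4, le_refl, h.le]

lemma gp_dt {S : Finset (ℝ × ℝ)} (hgp : GenPos S) {a b c : ℝ × ℝ} (ha : a ∈ S) (hb : b ∈ S)
    (hc : c ∈ S) (hab : a ≠ b) (hbc : b ≠ c) (hac : a ≠ c) : dt a b c ≠ 0 := by
  intro h0
  apply hgp {a, b, c} (by intro x hx; simp at hx; rcases hx with rfl | rfl | rfl <;> assumption)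
    (Finset.card_eq_three.2 ⟨a, b, c, hab, hac, hbc, rfl⟩)
  rw [collinear_iff_of_mem (p₀ := a) (by simp)]
  refine ⟨b - a, ?_⟩
  intro x hx
  simp only [Finset.coe_insert, Finset.coe_singleton, Set.mem_insert_iff,
    Set.mem_singleton_iff] at hx
  rcases hx with rfl | rfl | rfl
  · exact ⟨0, by simp⟩
  · exact ⟨1, by simp⟩
  · have hor : b.1 - a.1 ≠ 0 ∨ b.2 - a.2 ≠ 0 := by
      by_contra hcon
      push Not at hcon
      apply hab
      ext <;> linarith [hcon.1, hcon.2]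
    simp only [dt] at h0
    rcases hor with h | h
    · refine ⟨(x.1 - a.1) / (b.1 - a.1), ?_⟩
      ext
      · simp; field_simp; ring
      · simp; field_simp; linarith
    · refine ⟨(x.2 - a.2) / (b.2 - a.2), ?_⟩
      ext
      · simp; field_simp; linarith
      · simp; field_simp; ring

lemma exists_lf (S : Finset (ℝ × ℝ)) : ∃ t : ℝ, ∀ x ∈ S, ∀ y ∈ S, lf t x = lf t y → x = y := by
  obtain ⟨t, ht⟩ := Infinite.exists_notMem_finset
    ((S ×ˢ S).image (fun z => -(z.1.1 - z.2.1) / (z.1.2 - z.2.2)))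
  refine ⟨t, fun x hx y hy hxy => ?_⟩
  simp only [lf] at hxy
  by_cases h2 : x.2 - y.2 = 0
  · have h2' : x.2 = y.2 := by linarith
    rw [h2'] at hxy
    ext <;> linarith
  · exfalso
    apply ht
    refine Finset.mem_image.2 ⟨(x, y), Finset.mem_product.2 ⟨hx, hy⟩, ?_⟩
    simp only
    rw [div_eq_iff h2]
    linarith

/-- oriented representation of a triangle containing exactly one point -/
structure TriRep (S : Finset (ℝ × ℝ)) (t : ℝ) (T : Finset (ℝ × ℝ)) (s : ℝ) (q a b p : ℝ × ℝ) :
    Prop where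
  hs : s = 1 ∨ s = -1
  hT : T = {q, a, b}
  hq : q ∈ S
  ha : a ∈ S
  hb : b ∈ S
  hp : p ∈ S
  fa : lf t a < lf t q
  fb : lf t b < lf t q
  o : 0 < s * dt q a b
  o1 : 0 < s * dt q a p
  o2 : 0 < s * dt q p b
  o3 : 0 < s * dt a b p
  uniq : ∀ y ∈ S, 0 < s * dt q a y → 0 < s * dt q y b → 0 < s * dt a b y → y = p

lemma TriRep.symm {S : Finset (ℝ × ℝ)} {t : ℝ} {T : Finset (ℝ × ℝ)} {s : ℝ} {q a b p : ℝ × ℝ}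
    (h : TriRep S t T s q a b p) : TriRep S t T (-s) q b a p := by
  have e1 : ∀ q a b : ℝ × ℝ, -s * dt q b a = s * dt q a b := by intros; simp only [dt]; ring
  have e2 : ∀ q a b : ℝ × ℝ, -s * dt a q b = s * dt q a b := by intros; simp only [dt]; ring
  refine ⟨?_, ?_, h.hq, h.hb, h.ha, h.hp, h.fb, h.fa, ?_, ?_, ?_, ?_, ?_⟩
  · rcases h.hs with h | h <;> simp [h]
  · rw [h.hT, Finset.pair_comm]
  · rw [e1]; exact h.o
  · rw [e1]; exact h.o2
  · rw [e1]; exact h.o1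
  · rw [e2]; exact h.o3
  · intro y hy k1 k2 k3
    rw [e1] at k1 k2
    rw [e2] at k3
    exact h.uniq y hy k2 k1 k3

/-- the filtered family in the definition of `X` -/
noncomputable def fam (S : Finset (ℝ × ℝ)) (k l : ℕ) : Finset (Finset (ℝ × ℝ)) :=
  (Finset.powersetCard k S).filter (fun T => ConvexPos T ∧
    (S.filter (fun p => p ∈ interior (convexHull ℝ (T : Set (ℝ × ℝ))))).card = l)

lemma exists_rep_aux {S : Finset (ℝ × ℝ)} (hgp : GenPos S) {t : ℝ} {q a b : ℝ × ℝ}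
    (hT : ({q, a, b} : Finset (ℝ × ℝ)) ∈ fam S 3 1) (hqa : q ≠ a) (hqb : q ≠ b) (hab : a ≠ b)
    (fa : lf t a < lf t q) (fb : lf t b < lf t q) :
    ∃ s p, TriRep S t {q, a, b} s q a b p := by
  simp only [fam, Finset.mem_filter, Finset.mem_powersetCard] at hT
  obtain ⟨⟨hsub, -⟩, -, hcard⟩ := hT
  have hq : q ∈ S := hsub (by simp)
  have ha : a ∈ S := hsub (by simp)
  have hb : b ∈ S := hsub (by simp)
  have hd := gp_dt hgp hq ha hb hqa hab hqb
  obtain ⟨p, hp⟩ := Finset.card_eq_one.1 hcard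
  have hmem : ∀ y, (y ∈ S ∧ y ∈ interior (convexHull ℝ ({q, a, b} : Set (ℝ × ℝ)))) ↔ y = p := by
    intro y
    rw [← Finset.mem_singleton, ← hp, Finset.mem_filter]
    simp
  obtain ⟨s, hs, ho⟩ : ∃ s : ℝ, (s = 1 ∨ s = -1) ∧ 0 < s * dt q a b := by
    rcases lt_or_gt_of_ne hd with h | h
    · exact ⟨-1, Or.inr rfl, by linarith⟩
    · exact ⟨1, Or.inl rfl, by linarith⟩
  have e1 : ∀ y, dt b q y = dt q y b := by intro y; simp only [dt]; ring
  obtain ⟨hpS, hpi⟩ := (hmem p).2 rfl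
  obtain ⟨k1, k2, k3⟩ := tri_int s q a b p ho hpi
  refine ⟨s, p, hs, rfl, hq, ha, hb, hpS, fa, fb, ho, k1, by rwa [← e1], k2, ?_⟩
  intro y hy l1 l2 l3
  exact (hmem y).1 ⟨hy, tri_mem s q a b y l1 l3 (by rwa [e1])⟩

lemma exists_rep {S : Finset (ℝ × ℝ)} (hgp : GenPos S) {t : ℝ}
    (ht : ∀ x ∈ S, ∀ y ∈ S, lf t x = lf t y → x = y) {T : Finset (ℝ × ℝ)} (hT : T ∈ fam S 3 1) :
    ∃ s q a b p, TriRep S t T s q a b p := by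
  have hT' := hT
  simp only [fam, Finset.mem_filter, Finset.mem_powersetCard] at hT'
  obtain ⟨⟨hsub, hc⟩, -, -⟩ := hT'
  have hne : T.Nonempty := Finset.card_pos.1 (by omega)
  obtain ⟨q, hq, hmax⟩ := Finset.exists_max_image T (lf t) hne
  have hc2 : (T.erase q).card = 2 := by rw [Finset.card_erase_of_mem hq]; omega
  obtain ⟨a, b, hab, hTe⟩ := Finset.card_eq_two.1 hc2
  have hTq : T = {q, a, b} := by rw [← hTe, Finset.insert_erase hq]
  have ha : a ∈ T.erase q := by rw [hTe]; simp
  have hb : b ∈ T.erase q := by rw [hTe]; simp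
  obtain ⟨naq, ha⟩ := Finset.mem_erase.1 ha
  obtain ⟨nbq, hb⟩ := Finset.mem_erase.1 hb
  have fa : lf t a < lf t q :=
    lt_of_le_of_ne (hmax a ha) (fun h => naq (ht _ (hsub ha) _ (hsub hq) h))
  have fb : lf t b < lf t q :=
    lt_of_le_of_ne (hmax b hb) (fun h => nbq (ht _ (hsub hb) _ (hsub hq) h))
  subst hTq
  obtain ⟨s, p, h⟩ := exists_rep_aux hgp hT naq.symm nbq.symm hab fa fb
  exact ⟨s, q, a, b, p, h⟩

/-- `Q` arises from the triangle `T` by adding a point beyond an edge at the top vertex. -/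
def Flip (S : Finset (ℝ × ℝ)) (t : ℝ) (T Q : Finset (ℝ × ℝ)) : Prop :=
  ∃ s q a b p x, TriRep S t T s q a b p ∧ Q = {q, x, a, b} ∧ x ∈ S ∧ lf t x < lf t q ∧
    0 < s * dt q x a ∧ 0 < s * dt a b x ∧ p ∈ interior (convexHull ℝ (Q : Set (ℝ × ℝ)))

lemma trans_dt {t s : ℝ} {q x y z : ℝ × ℝ} (hx : lf t x < lf t q) (hy : lf t y < lf t q)
    (hz : lf t z < lf t q) (h1 : 0 < s * dt q x y) (h2 : 0 < s * dt q y z) :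
    0 < s * dt q x z := by
  have key : (lf t q - lf t y) * (s * dt q x z) =
      (lf t q - lf t x) * (s * dt q y z) + (lf t q - lf t z) * (s * dt q x y) := by
    simp only [lf, dt]; ring
  have h3 := mul_pos (sub_pos.2 hx) h2
  have h4 := mul_pos (sub_pos.2 hz) h1
  exact pos_of_mul_pos_right (by rw [key]; linarith) (sub_pos.2 hy).le

lemma notMem_hull {s : ℝ} {a b y : ℝ × ℝ} {T : Set (ℝ × ℝ)} (h : s * dt a b y < 0)
    (hT : ∀ x ∈ T, x ≠ y → 0 ≤ s * dt a b x) : y ∉ convexHull ℝ (T \ {y}) := by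
  intro hy
  have := hull_half s a b (T \ {y}) (fun x hx => hT x hx.1 hx.2) y hy
  linarith

lemma flip_exists {S : Finset (ℝ × ℝ)} (hgp : GenPos S) {t : ℝ}
    {T : Finset (ℝ × ℝ)} {s : ℝ} {q a b p : ℝ × ℝ}
    (h : TriRep S t T s q a b p) {c : ℝ × ℝ} (hc : c ∈ S) (fc : lf t c < lf t q)
    (hca : 0 < s * dt q c a) (hcb : 0 < s * dt a b c) : ∃ Q ∈ fam S 4 1, Flip S t T Q := by
  obtain ⟨x, hxE, hmin⟩ := Finset.exists_min_image
    (S.filter (fun c => lf t c < lf t q ∧ 0 < s * dt q c a ∧ 0 < s * dt a b c))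
    (fun c => s * dt q c a) ⟨c, by simp [hc, fc, hca, hcb]⟩
  obtain ⟨hx, fx, hxa, hxb⟩ := by simpa using hxE
  have hs : s ≠ 0 := by rcases h.hs with h | h <;> simp [h]
  have hxqb : 0 < s * dt q x b := trans_dt fx h.fa h.fb hxa h.o
  obtain ⟨nqa, nab, nqb⟩ := ne_of_dt h.o
  obtain ⟨nqx, nxa, -⟩ := ne_of_dt hxa
  obtain ⟨-, nbx, -⟩ := ne_of_dt hxb
  have z1 : ∀ a b : ℝ × ℝ, dt a b a = 0 := by intros; simp only [dt]; ring
  have z2 : ∀ a b : ℝ × ℝ, dt a b b = 0 := by intros; simp only [dt]; ring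
  have r1 : ∀ a b c : ℝ × ℝ, dt b c a = dt a b c := by intros; simp only [dt]; ring
  have r2 : ∀ a b c : ℝ × ℝ, dt c a b = dt a b c := by intros; simp only [dt]; ring
  have r3 : ∀ a b c : ℝ × ℝ, dt b a c = -dt a b c := by intros; simp only [dt]; ring
  have r4 : ∀ a b c : ℝ × ℝ, dt a c b = -dt a b c := by intros; simp only [dt]; ring
  have hpQ : p ∈ interior (convexHull ℝ ((({q, x, a, b} : Finset (ℝ × ℝ))) : Set (ℝ × ℝ))) := by
    refine interior_mono (convexHull_mono ?_) (tri_mem s q a b p h.o1 h.o3 ?_)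
    · intro y hy
      simp at hy ⊢
      tauto
    · rw [r2]; rw [← r1 q p b, r1]; have := h.o2; rwa [← r2 q p b, r2] at this ⊢
  refine ⟨{q, x, a, b}, ?_, s, q, a, b, p, x, h, rfl, hx, fx, hxa, hxb, hpQ⟩
  simp only [fam, Finset.mem_filter, Finset.mem_powersetCard]
  refine ⟨⟨?_, ?_⟩, ?_, ?_⟩
  · intro y hy
    simp at hy
    rcases hy with rfl | rfl | rfl | rfl
    exacts [h.hq, hx, h.ha, h.hb]
  · rw [Finset.card_insert_of_notMem, Finset.card_insert_of_notMem, Finset.card_insert_of_notMem,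
      Finset.card_singleton]
    · simpa using nab
    · simp [nxa, nbx.symm]
    · simp [nqx, nqa, nqb]
  · intro y hy
    have hT : ∀ P : ℝ × ℝ → Prop, (y ≠ q → P q) → (y ≠ x → P x) → (y ≠ a → P a) → (y ≠ b → P b) →
        ∀ z ∈ ((({q, x, a, b} : Finset (ℝ × ℝ))) : Set (ℝ × ℝ)), z ≠ y → P z := by
      intro P p1 p2 p3 p4 z hz hzy
      simp at hz
      rcases hz with rfl | rfl | rfl | rfl
      exacts [p1 hzy.symm, p2 hzy.symm, p3 hzy.symm, p4 hzy.symm]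
    have oqab := h.o
    simp at hy
    rcases hy with rfl | rfl | rfl | rfl
    · refine notMem_hull (s := s) (a := b) (b := x) ?_ (hT _ ?_ ?_ ?_ ?_)
      · have := hxqb; simp only [dt] at *; linarith
      all_goals intro _; first | exact absurd rfl ‹_› | (simp only [dt] at *; linarith)
    · refine notMem_hull (s := s) (a := q) (b := a) ?_ (hT _ ?_ ?_ ?_ ?_)
      · simp only [dt] at *; linarith
      all_goals intro _; first | exact absurd rfl ‹_› | (simp only [dt] at *; linarith)
    · refine notMem_hull (s := s) (a := x) (b := b) ?_ (hT _ ?_ ?_ ?_ ?_)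
      · simp only [dt] at *; linarith
      all_goals intro _; first | exact absurd rfl ‹_› | (simp only [dt] at *; linarith)
    · refine notMem_hull (s := s) (a := a) (b := q) ?_ (hT _ ?_ ?_ ?_ ?_)
      · simp only [dt] at *; linarith
      all_goals intro _; first | exact absurd rfl ‹_› | (simp only [dt] at *; linarith)
  · rw [Finset.card_eq_one]
    refine ⟨p, ?_⟩
    ext y
    simp only [Finset.mem_filter, Finset.mem_singleton]
    constructor
    swap
    · rintro rfl; exact ⟨h.hp, hpQ⟩
    rintro ⟨hy, hyQ⟩
    have hall : ∀ u v : ℝ × ℝ, u ≠ v → 0 ≤ s * dt u v q → 0 ≤ s * dt u v x → 0 ≤ s * dt u v a →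
        0 ≤ s * dt u v b → 0 < s * dt u v y := by
      intro u v huv p1 p2 p3 p4
      refine int_half s hs u v huv _ ?_ y hyQ
      intro z hz
      simp at hz
      rcases hz with rfl | rfl | rfl | rfl <;> assumption
    have oqab := h.o
    have y1 : 0 < s * dt q x y := by
      apply hall q x nqx <;> (simp only [dt] at *; linarith)
    have y2 : 0 < s * dt x a y := by
      apply hall x a nxa <;> (simp only [dt] at *; linarith)
    have y3 : 0 < s * dt a b y := by
      apply hall a b nab <;> (simp only [dt] at *; linarith)
    have y4 : 0 < s * dt b q y := by
      apply hall b q nqb.symm <;> (simp only [dt] at *; linarith)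
    have nqy : q ≠ y := (ne_of_dt y1).2.2
    have nay : a ≠ y := (ne_of_dt y2).2.1
    have hd := gp_dt hgp h.hq h.ha hy nqa nay nqy
    have hd' : s * dt q a y ≠ 0 := mul_ne_zero hs hd
    rcases lt_or_gt_of_ne hd' with hlt | hgt
    · exfalso
      have m1 : 0 < s * dt q y a := by rw [r4]; linarith
      have fy : lf t y < lf t q := by
        have key : s * dt q x a * (lf t q - lf t y) =
            s * dt q y a * (lf t q - lf t x) + s * dt q x y * (lf t q - lf t a) := by
          simp only [lf, dt]; ring
        have k1 := mul_pos m1 (sub_pos.2 fx)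
        have k2 := mul_pos y1 (sub_pos.2 h.fa)
        have := pos_of_mul_pos_right (by rw [key]; linarith) hxa.le
        linarith
      have := hmin y (by simp [hy, fy, m1, y3])
      have e : s * dt q x a = s * dt q y a + s * dt q x y + s * dt x a y := by
        simp only [dt]; ring
      linarith
    · refine h.uniq y hy hgt ?_ y3
      have := y4; simp only [dt] at this ⊢; linarith

lemma flip_exists' {S : Finset (ℝ × ℝ)} (hgp : GenPos S) {t : ℝ}
    {T : Finset (ℝ × ℝ)} {s : ℝ} {q a b p : ℝ × ℝ}
    (h : TriRep S t T s q a b p) {c : ℝ × ℝ} (hc : c ∈ S) (fc : lf t c < lf t q) (hcp : c ≠ p)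
    (hcb : 0 < s * dt a b c) : ∃ Q ∈ fam S 4 1, Flip S t T Q := by
  have hs : s ≠ 0 := by rcases h.hs with h | h <;> simp [h]
  obtain ⟨nqa, nab, nqb⟩ := ne_of_dt h.o
  obtain ⟨-, nbc, nac⟩ := ne_of_dt hcb
  have nqc : q ≠ c := by rintro rfl; exact lt_irrefl _ fc
  by_cases h1 : 0 < s * dt q c a
  · exact flip_exists hgp h hc fc h1 hcb
  by_cases h2 : 0 < s * dt q b c
  · refine flip_exists hgp h.symm hc fc ?_ ?_ <;> (simp only [dt] at *; linarith)
  exfalso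
  have d1 := mul_ne_zero hs (gp_dt hgp h.hq hc h.ha nqc nac.symm nqa)
  have d2 := mul_ne_zero hs (gp_dt hgp h.hq h.hb hc nqb nbc nqc)
  have l1 := lt_of_le_of_ne (not_lt.1 h1) d1
  have l2 := lt_of_le_of_ne (not_lt.1 h2) d2
  apply hcp
  apply h.uniq c hc _ _ hcb <;> (simp only [dt] at *; linarith)

lemma flip_inj {S : Finset (ℝ × ℝ)} {t : ℝ} {T T' Q : Finset (ℝ × ℝ)} (hQ : Q ∈ fam S 4 1)
    (h : Flip S t T Q) (h' : Flip S t T' Q) : T = T' := by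
  obtain ⟨s, q, a, b, p, x, R, hQ1, hx, fx, hxa, hxb, hp⟩ := h
  obtain ⟨s', q', a', b', p', x', R', hQ2, hx', fx', hxa', hxb', hp'⟩ := h'
  simp only [fam, Finset.mem_filter, Finset.mem_powersetCard] at hQ
  obtain ⟨-, -, hcard⟩ := hQ
  have hpp : p = p' := by
    obtain ⟨r, hr⟩ := Finset.card_eq_one.1 hcard
    have h1 : p ∈ ({r} : Finset (ℝ × ℝ)) := by rw [← hr]; simp [R.hp, hp]
    have h2 : p' ∈ ({r} : Finset (ℝ × ℝ)) := by rw [← hr]; simp [R'.hp, hp']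
    simp at h1 h2
    rw [h1, h2]
  subst hpp
  have hEq : ({q, x, a, b} : Finset (ℝ × ℝ)) = {q', x', a', b'} := by rw [← hQ1, hQ2]
  have hmem : ∀ z, (z = q ∨ z = x ∨ z = a ∨ z = b) ↔ (z = q' ∨ z = x' ∨ z = a' ∨ z = b') := by
    intro z
    have := Finset.ext_iff.1 hEq z
    simpa using this
  have hqq : q = q' := by
    have f1 := R.fa
    have f2 := R.fb
    have f3 := R'.fa
    have f4 := R'.fb
    rcases (hmem q).1 (Or.inl rfl) with e | e | e | e
    · exact e
    all_goals
      rcases (hmem q').2 (Or.inl rfl) with e' | e' | e' | e'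
      · exact e'.symm
      all_goals (exfalso; have g := congrArg (lf t) e; have g' := congrArg (lf t) e'; linarith)
  subst hqq
  have oxb : 0 < s * dt q x b := trans_dt fx R.fa R.fb hxa R.o
  obtain ⟨nqa', nab', nqb'⟩ := ne_of_dt R'.o
  obtain ⟨nqx', nxa', -⟩ := ne_of_dt hxa'
  obtain ⟨-, nbx', -⟩ := ne_of_dt hxb'
  have o := R.o
  have o1 := R.o1
  have o2 := R.o2
  have o3 := R.o3
  have o' := R'.o
  have o1' := R'.o1
  have o2' := R'.o2
  have o3' := R'.o3
  have ma := (hmem a').2 (by simp)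
  have mb := (hmem b').2 (by simp)
  have mx := (hmem x').2 (by simp)
  have hxx := hmem x
  have haa := hmem a
  rw [R.hT, R'.hT]
  have hs := R.hs
  have hs' := R'.hs
  rcases ma with rfl | rfl | rfl | rfl
  · exact absurd rfl nqa'
  · skip
    rcases mb with rfl | rfl | rfl | rfl
    · exact absurd rfl nqb'
    · exact absurd rfl nab'
    · exfalso
      rcases hs with rfl | rfl <;> rcases hs' with rfl | rfl <;> (simp only [dt] at *; linarith)
    · have : x' = a := by
        rcases mx with rfl | rfl | rfl | rfl
        · exact absurd rfl nqx'
        · exact absurd rfl nxa'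
        · rfl
        · exact absurd rfl nbx'
      subst this
      exfalso
      clear hmem hxx haa hEq
      rcases hs with rfl | rfl <;> rcases hs' with rfl | rfl <;> (simp only [dt] at *; linarith)
  · rcases mb with rfl | rfl | rfl | rfl
    · exact absurd rfl nqb'
    · exfalso
      rcases hs with rfl | rfl <;> rcases hs' with rfl | rfl <;> (simp only [dt] at *; linarith)
    · exact absurd rfl nab'
    · rfl
  · rcases mb with rfl | rfl | rfl | rfl
    · exact absurd rfl nqb'
    · have : x' = a := by
        rcases mx with rfl | rfl | rfl | rfl
        · exact absurd rfl nqx'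
        · exact absurd rfl nbx'
        · rfl
        · exact absurd rfl nxa'
      subst this
      exfalso
      clear hmem hxx haa hEq
      rcases hs with rfl | rfl <;> rcases hs' with rfl | rfl <;> (simp only [dt] at *; linarith)
    · rw [Finset.pair_comm]
    · exact absurd rfl nab'

lemma TriRep.one {S : Finset (ℝ × ℝ)} {t : ℝ} {T : Finset (ℝ × ℝ)} {s : ℝ} {q a b p : ℝ × ℝ}
    (h : TriRep S t T s q a b p) : ∃ a b, TriRep S t T 1 q a b p := by
  rcases h.hs with rfl | rfl
  · exact ⟨a, b, h⟩
  · exact ⟨b, a, by simpa using h.symm⟩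

lemma TriRep.ne_p {S : Finset (ℝ × ℝ)} {t : ℝ} {T : Finset (ℝ × ℝ)} {s : ℝ} {q a b p : ℝ × ℝ}
    (h : TriRep S t T s q a b p) : q ≠ p ∧ a ≠ p ∧ b ≠ p :=
  ⟨(ne_of_dt h.o1).2.2, (ne_of_dt h.o1).2.1, (ne_of_dt h.o3).2.1⟩

lemma special_max {S : Finset (ℝ × ℝ)} {t : ℝ}
    {T T' : Finset (ℝ × ℝ)} {q a b q' a' b' p : ℝ × ℝ}
    (R : TriRep S t T 1 q a b p) (R' : TriRep S t T' 1 q' a' b' p)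
    (hsp' : ∀ c ∈ S, lf t c < lf t q' → c ≠ p → dt a' b' c ≤ 0) : ¬ lf t q < lf t q' := by
  intro hlt
  have o := R.o
  have o1 := R.o1
  have o2 := R.o2
  have o3 := R.o3
  have o3' := R'.o3
  rw [one_mul] at *
  obtain ⟨n1, n2, n3⟩ := R.ne_p
  have h1 := hsp' q R.hq hlt n1
  have h2 := hsp' a R.ha (R.fa.trans hlt) n2
  have h3 := hsp' b R.hb (R.fb.trans hlt) n3
  have key : dt q a b * dt a' b' p =
      dt a b p * dt a' b' q + dt q p b * dt a' b' a + dt q a p * dt a' b' b := by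
    simp only [dt]; ring
  have := mul_pos o o3'
  have k1 := mul_nonpos_of_nonneg_of_nonpos o3.le h1
  have k2 := mul_nonpos_of_nonneg_of_nonpos o2.le h2
  have k3 := mul_nonpos_of_nonneg_of_nonpos o1.le h3
  linarith

lemma special_inj {S : Finset (ℝ × ℝ)} (hgp : GenPos S) {t : ℝ}
    (ht : ∀ x ∈ S, ∀ y ∈ S, lf t x = lf t y → x = y)
    {T T' : Finset (ℝ × ℝ)} {q a b q' a' b' p : ℝ × ℝ}
    (R : TriRep S t T 1 q a b p) (R' : TriRep S t T' 1 q' a' b' p)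
    (hsp : ∀ c ∈ S, lf t c < lf t q → c ≠ p → dt a b c ≤ 0)
    (hsp' : ∀ c ∈ S, lf t c < lf t q' → c ≠ p → dt a' b' c ≤ 0) : T = T' := by
  have hq : q = q' := ht _ R.hq _ R'.hq
    (le_antisymm (not_lt.1 (special_max R' R hsp)) (not_lt.1 (special_max R R' hsp')))
  subst hq
  obtain ⟨n1, n2, n3⟩ := R.ne_p
  obtain ⟨n1', n2', n3'⟩ := R'.ne_p
  have o := R.o
  have o1 := R.o1
  have o2 := R.o2
  have o' := R'.o
  have o1' := R'.o1
  have o2' := R'.o2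
  have nab := (ne_of_dt o).2.1
  have nab' := (ne_of_dt o').2.1
  rw [one_mul] at o o1 o2 o' o1' o2'
  have h1 := hsp a' R'.ha R'.fa n2'
  have h2 := hsp b' R'.hb R'.fb n3'
  have h1' := hsp' a R.ha R.fa n2
  have h2' := hsp' b R.hb R.fb n3
  have key : dt q p b' * dt a b a' + dt q a' p * dt a b b' +
      (dt q p b * dt a' b' a + dt q a p * dt a' b' b) = 0 := by
    simp only [dt]; ring
  have k1 := mul_nonpos_of_nonneg_of_nonpos o2'.le h1
  have k2 := mul_nonpos_of_nonneg_of_nonpos o1'.le h2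
  have k3 := mul_nonpos_of_nonneg_of_nonpos o2.le h1'
  have k4 := mul_nonpos_of_nonneg_of_nonpos o1.le h2'
  have z1 : dt a b a' = 0 := by
    have : dt q p b' * dt a b a' = 0 := by linarith
    exact (mul_eq_zero.1 this).resolve_left o2'.ne'
  have z2 : dt a b b' = 0 := by
    have : dt q a' p * dt a b b' = 0 := by linarith
    exact (mul_eq_zero.1 this).resolve_left o1'.ne'
  have m1 : a' = a ∨ a' = b := by
    by_contra hcon
    push Not at hcon
    exact gp_dt hgp R.ha R.hb R'.ha nab hcon.2.symm hcon.1.symm z1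
  have m2 : b' = a ∨ b' = b := by
    by_contra hcon
    push Not at hcon
    exact gp_dt hgp R.ha R.hb R'.hb nab hcon.2.symm hcon.1.symm z2
  rw [R.hT, R'.hT]
  rcases m1 with rfl | rfl <;> rcases m2 with rfl | rfl
  · exact absurd rfl nab'
  · rfl
  · rw [Finset.pair_comm]
  · exact absurd rfl nab'

theorem stmt4 (S : Finset (ℝ × ℝ)) (hgp : GenPos S) :
    (X S 3 1 : ℤ) - S.card + hullVerts S ≤ X S 4 1 := by
  obtain ⟨t, ht⟩ := exists_lf S
  have hX3 : X S 3 1 = (fam S 3 1).card := rfl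
  have hX4 : X S 4 1 = (fam S 4 1).card := rfl
  set N := (fam S 3 1).filter (fun T => ∃ Q ∈ fam S 4 1, Flip S t T Q) with hN
  set P := (fam S 3 1).filter (fun T => ¬ ∃ Q ∈ fam S 4 1, Flip S t T Q) with hP
  have hsplit : N.card + P.card = (fam S 3 1).card :=
    Finset.card_filter_add_card_filter_not _
  have hN4 : N.card ≤ (fam S 4 1).card := by
    have hch : ∀ T ∈ N, ∃ Q, Q ∈ fam S 4 1 ∧ Flip S t T Q := by
      intro T hT
      obtain ⟨Q, h1, h2⟩ := (Finset.mem_filter.1 hT).2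
      exact ⟨Q, h1, h2⟩
    choose! F hF using hch
    refine Finset.card_le_card_of_injOn F (fun T hT => (hF T hT).1) ?_
    intro T hT T' hT' hTT
    have h1 := hF T hT
    have h2 := hF T' hT'
    rw [← hTT] at h2
    exact flip_inj h1.1 h1.2 h2.2
  have hPn : P.card ≤ (S.filter (fun p => ¬ p ∉ convexHull ℝ ((S : Set (ℝ × ℝ)) \ {p}))).card := by
    have hch : ∀ T ∈ P, ∃ p q a b, TriRep S t T 1 q a b p := by
      intro T hT
      obtain ⟨s, q, a, b, p, R⟩ := exists_rep hgp ht (Finset.mem_filter.1 hT).1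
      obtain ⟨a, b, R⟩ := R.one
      exact ⟨p, q, a, b, R⟩
    choose! F hF using hch
    have hsp : ∀ T ∈ P, ∀ q a b p, TriRep S t T 1 q a b p →
        ∀ c ∈ S, lf t c < lf t q → c ≠ p → dt a b c ≤ 0 := by
      intro T hT q a b p R c hc fc hcp
      by_contra hcon
      exact (Finset.mem_filter.1 hT).2
        (flip_exists' hgp R hc fc hcp (by rw [one_mul]; exact not_le.1 hcon))
    refine Finset.card_le_card_of_injOn F ?_ ?_
    · intro T hT
      obtain ⟨q, a, b, R⟩ := hF T hT
      simp only [Finset.coe_filter, Set.mem_ofPred_eq, not_not]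
      refine ⟨R.hp, ?_⟩
      obtain ⟨n1, n2, n3⟩ := R.ne_p
      have e1 : dt b q (F T) = dt q (F T) b := by simp only [dt]; ring
      have hm := interior_subset (tri_mem 1 q a b (F T) R.o1 R.o3 (by rw [e1]; exact R.o2))
      refine convexHull_mono ?_ hm
      intro z hz
      simp only [Set.mem_insert_iff, Set.mem_singleton_iff] at hz
      rcases hz with rfl | rfl | rfl
      exacts [⟨R.hq, n1⟩, ⟨R.ha, n2⟩, ⟨R.hb, n3⟩]
    · intro T hT T' hT' hTT
      obtain ⟨q, a, b, R⟩ := hF T hT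
      obtain ⟨q', a', b', R'⟩ := hF T' hT'
      rw [← hTT] at R'
      exact special_inj hgp ht R R' (hsp T hT _ _ _ _ R) (hsp T' hT' _ _ _ _ R')
  have hsum : hullVerts S +
      (S.filter (fun p => ¬ p ∉ convexHull ℝ ((S : Set (ℝ × ℝ)) \ {p}))).card = S.card :=
    Finset.card_filter_add_card_filter_not _
  rw [hX3, hX4]
  omega
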